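/- The observable space W(ℂ²), with the topology induced by the metric D_W, is homeomorphic to the real projective plane: the map sending a unit vector n ∈ S² ⊂ ℝ³ to the complete orthonormal decomposition {½(I − n·σ), ½(I + n·σ)} identifies antipodal points n and −n, and the induced map from the quotient S²/{±1} (with the quotient topology) to W(ℂ²) is a homeomorphism. -/

import Mathlib

/- STATEMENT 5: W(ℂ²) with the topology of the metric D_W is homeomorphic to the
real projective plane S²/{±1}: the map n ↦ {½(I − n·σ), ½(I + n·σ)} identifies
antipodes and induces a homeomorphism from the quotient onto W(ℂ²). -/

noncomputable section

abbrev E2 : Type := EuclideanSpace ℂ (Fin 2)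
abbrev Op2 : Type := E2 →L[ℂ] E2

def IsProj1 (p : Op2) : Prop :=
  IsSelfAdjoint p ∧ p * p = p ∧ Module.finrank ℂ (LinearMap.range (p : E2 →ₗ[ℂ] E2)) = 1

/-- `O` is a complete orthonormal decomposition in `ℂ²`. -/
def IsCOD (O : Set Op2) : Prop :=
  O.Finite ∧ O.ncard = 2 ∧ (∀ p ∈ O, IsProj1 p) ∧
    (∀ p ∈ O, ∀ q ∈ O, p ≠ q → p * q = 0) ∧ (∑ᶠ p ∈ O, p) = 1

/-- The observable space `W(ℂ²)`. -/
def W2 : Type := {O : Set Op2 // IsCOD O}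

/-- The distance `D_W` on `W(ℂ²)`. -/
def DW (O O' : Set Op2) : ℝ :=
  sInf {r : ℝ | ∃ U : Op2, U ∈ unitary Op2 ∧
    ((fun p => star U * p * U) '' O') = O ∧ r = ‖1 - U‖}

/-- The topology on `W(ℂ²)` induced by the metric `D_W` (generated by open balls). -/
def WTop : TopologicalSpace W2 :=
  TopologicalSpace.generateFrom
    {s : Set W2 | ∃ (O : W2) (r : ℝ), s = {O' : W2 | DW O.1 O'.1 < r}}

/-- The Pauli matrices, as operators on `ℂ²`. -/
def sigmaX : Op2 := Matrix.toEuclideanCLM (𝕜 := ℂ) !![0, 1; 1, 0]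
def sigmaY : Op2 := Matrix.toEuclideanCLM (𝕜 := ℂ) !![0, -Complex.I; Complex.I, 0]
def sigmaZ : Op2 := Matrix.toEuclideanCLM (𝕜 := ℂ) !![1, 0; 0, -1]

/-- `n·σ` for `n ∈ ℝ³`. -/
def nDotSigma (n : EuclideanSpace ℝ (Fin 3)) : Op2 :=
  (n 0 : ℂ) • sigmaX + (n 1 : ℂ) • sigmaY + (n 2 : ℂ) • sigmaZ

/-- The unit sphere `S² ⊂ ℝ³`. -/
abbrev Sph : Type := Metric.sphere (0 : EuclideanSpace ℝ (Fin 3)) 1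

/-- The antipodal relation on `S²`; the quotient `Quot antipodal` is `S²/{±1}`,
carrying the quotient topology. -/
def antipodal (x y : Sph) : Prop :=
  (y : EuclideanSpace ℝ (Fin 3)) = -(x : EuclideanSpace ℝ (Fin 3))

/-- `½(I − n·σ)` and `½(I + n·σ)`. -/
def projMinus (n : Sph) : Op2 := (2 : ℂ)⁻¹ • (1 - nDotSigma (n : EuclideanSpace ℝ (Fin 3)))
def projPlus (n : Sph) : Op2 := (2 : ℂ)⁻¹ • (1 + nDotSigma (n : EuclideanSpace ℝ (Fin 3)))

/-- The matrix of `n·σ`. -/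
def pauliMatrix (n : EuclideanSpace ℝ (Fin 3)) : Matrix (Fin 2) (Fin 2) ℂ :=
  !![(n 2 : ℂ), n 0 - Complex.I * n 1; n 0 + Complex.I * n 1, -(n 2 : ℂ)]

lemma nDotSigma_eq_toEuclideanCLM (n : EuclideanSpace ℝ (Fin 3)) :
    nDotSigma n = Matrix.toEuclideanCLM (𝕜 := ℂ) (pauliMatrix n) := by
  simp only [nDotSigma, sigmaX, sigmaY, sigmaZ, ← map_smul, ← map_add]
  congr 1
  ext i j
  fin_cases i <;> fin_cases j <;> simp [pauliMatrix] <;> ring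

lemma star_nDotSigma (n : EuclideanSpace ℝ (Fin 3)) : star (nDotSigma n) = nDotSigma n := by
  rw [nDotSigma_eq_toEuclideanCLM, ← map_star]
  congr 1
  ext i j
  fin_cases i <;> fin_cases j <;> simp [pauliMatrix, Matrix.star_apply] <;> ring

lemma nDotSigma_anticommutator (n m : EuclideanSpace ℝ (Fin 3)) :
    nDotSigma n * nDotSigma m + nDotSigma m * nDotSigma n
      = ((2 * inner ℝ n m : ℝ) : ℂ) • (1 : Op2) := by
  simp only [nDotSigma_eq_toEuclideanCLM, ← map_mul, ← map_add]
  rw [← map_one (Matrix.toEuclideanCLM (𝕜 := ℂ) (n := Fin 2)), ← map_smul]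
  congr 1
  ext i j
  fin_cases i <;> fin_cases j <;>
    simp [pauliMatrix, Fin.sum_univ_succ, PiLp.inner_apply] <;>
    ring_nf <;> simp

lemma nDotSigma_mul_self (n : Sph) : nDotSigma n * nDotSigma n = 1 := by
  have h := nDotSigma_anticommutator (n : EuclideanSpace ℝ (Fin 3)) n
  rw [real_inner_self_eq_norm_sq, mem_sphere_zero_iff_norm.1 n.2, ← two_smul ℂ] at h
  simpa using h

lemma nDotSigma_neg (n : EuclideanSpace ℝ (Fin 3)) : nDotSigma (-n) = -nDotSigma n := by
  simp only [nDotSigma, PiLp.neg_apply, Complex.ofReal_neg]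
  module

lemma nDotSigma_injective : Function.Injective nDotSigma := by
  intro n m h
  simp only [nDotSigma_eq_toEuclideanCLM] at h
  replace h := (Matrix.toEuclideanCLM (𝕜 := ℂ) (n := Fin 2)).injective h
  have h00 := congrFun (congrFun h 0) 0
  have h10 := congrFun (congrFun h 1) 0
  simp [pauliMatrix, Complex.ext_iff] at h00 h10
  ext i
  fin_cases i
  · exact h10.1
  · exact h10.2
  · exact h00

lemma continuous_nDotSigma : Continuous nDotSigma := by
  unfold nDotSigma
  fun_prop

lemma nDotSigma_ne_smul_one (n : Sph) (c : ℂ) : nDotSigma n ≠ c • (1 : Op2) := by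
  intro h
  have hsq := nDotSigma_mul_self n
  rw [nDotSigma_eq_toEuclideanCLM, ← map_one (Matrix.toEuclideanCLM (𝕜 := ℂ) (n := Fin 2)),
    ← map_smul] at h
  have h' := (Matrix.toEuclideanCLM (𝕜 := ℂ) (n := Fin 2)).injective h
  have h00 := congrFun (congrFun h' 0) 0
  have h11 := congrFun (congrFun h' 1) 1
  simp [pauliMatrix] at h00 h11
  have hc : c = 0 := by linear_combination (-1 / 2 : ℂ) * h00 - (1 / 2 : ℂ) * h11
  rw [nDotSigma_eq_toEuclideanCLM, h, hc] at hsq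
  simp at hsq

lemma finrank_range_eq_one_iff {p : Op2} (hp : p * p = p) :
    Module.finrank ℂ (LinearMap.range (p : E2 →ₗ[ℂ] E2)) = 1 ↔ p ≠ 0 ∧ p ≠ 1 := by
  have hE : Module.finrank ℂ E2 = 2 := by simp
  constructor
  · intro h
    constructor
    · rintro rfl
      have : LinearMap.range ((0 : Op2) : E2 →ₗ[ℂ] E2) = ⊥ :=
        LinearMap.range_eq_bot.2 rfl
      rw [this, finrank_bot] at h
      omega
    · rintro rfl
      have : LinearMap.range ((1 : Op2) : E2 →ₗ[ℂ] E2) = ⊤ :=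
        LinearMap.range_eq_top.2 fun x => ⟨x, rfl⟩
      rw [this, finrank_top, hE] at h
      omega
  · rintro ⟨h0, h1⟩
    have hle := Submodule.finrank_le (LinearMap.range (p : E2 →ₗ[ℂ] E2))
    rw [hE] at hle
    have hn0 : Module.finrank ℂ (LinearMap.range (p : E2 →ₗ[ℂ] E2)) ≠ 0 := by
      intro h
      rw [Submodule.finrank_eq_zero, LinearMap.range_eq_bot] at h
      apply h0
      ext1 x
      exact LinearMap.congr_fun h x
    have hn2 : Module.finrank ℂ (LinearMap.range (p : E2 →ₗ[ℂ] E2)) ≠ 2 := by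
      intro h
      have ht := Submodule.eq_top_of_finrank_eq (h.trans hE.symm)
      apply h1
      ext1 x
      obtain ⟨y, rfl⟩ := LinearMap.range_eq_top.1 ht x
      exact congrArg (fun f : Op2 => f y) hp
    omega

lemma projMinus_add_projPlus (n : Sph) : projMinus n + projPlus n = 1 := by
  simp only [projMinus, projPlus]
  module

lemma projPlus_sub_projMinus (n : Sph) : projPlus n - projMinus n = nDotSigma n := by
  simp only [projMinus, projPlus]
  module

lemma projMinus_eq (n : Sph) : projMinus n = projPlus (-n) := by
  simp [projMinus, projPlus, nDotSigma_neg, sub_eq_add_neg]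

lemma projPlus_injective : Function.Injective projPlus := by
  intro n m h
  have h' := smul_right_injective Op2 (inv_ne_zero (two_ne_zero' ℂ)) h
  exact Subtype.ext (nDotSigma_injective (add_left_cancel h'))

lemma isProj1_projPlus (n : Sph) : IsProj1 (projPlus n) := by
  have hS := nDotSigma_mul_self n
  have hidem : projPlus n * projPlus n = projPlus n := by
    simp only [projPlus, smul_mul_smul_comm, mul_add, add_mul, hS, one_mul, mul_one]
    module
  refine ⟨?_, hidem, (finrank_range_eq_one_iff hidem).2 ⟨fun h => ?_, fun h => ?_⟩⟩
  · have h1 : star (1 + nDotSigma n) = 1 + nDotSigma n := by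
      refine (star_add (1 : Op2) _).trans ?_
      rw [star_nDotSigma, star_one]
    rw [IsSelfAdjoint, projPlus, star_smul, h1]
    simp
  · apply nDotSigma_ne_smul_one n (-1)
    have : nDotSigma n = (2 : ℂ) • projPlus n - 1 := by simp only [projPlus]; module
    rw [this, h]
    module
  · apply nDotSigma_ne_smul_one n 1
    have : nDotSigma n = (2 : ℂ) • projPlus n - 1 := by simp only [projPlus]; module
    rw [this, h]
    module

lemma isProj1_projMinus (n : Sph) : IsProj1 (projMinus n) :=
  projMinus_eq n ▸ isProj1_projPlus (-n)

lemma projMinus_ne_projPlus (n : Sph) : projMinus n ≠ projPlus n := by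
  intro h
  apply nDotSigma_ne_smul_one n 0
  rw [← projPlus_sub_projMinus, h, sub_self]
  module

/-- The decomposition `{½(I − n·σ), ½(I + n·σ)}`. -/
def sphereToW2 (n : Sph) : W2 := by
  refine ⟨{projMinus n, projPlus n}, Set.toFinite _, Set.ncard_pair (projMinus_ne_projPlus n),
    ?_, ?_, ?_⟩
  · rintro p (rfl | rfl)
    exacts [isProj1_projMinus n, isProj1_projPlus n]
  · have hp := (isProj1_projPlus n).2.1
    have hm : projMinus n = 1 - projPlus n := eq_sub_of_add_eq (projMinus_add_projPlus n)
    rintro p (rfl | rfl) q (rfl | rfl) hpq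
    · exact absurd rfl hpq
    · rw [hm, sub_mul, hp, one_mul, sub_self]
    · rw [hm, mul_sub, hp, mul_one, sub_self]
    · exact absurd rfl hpq
  · rw [finsum_mem_pair (projMinus_ne_projPlus n), projMinus_add_projPlus]

lemma sphereToW2_neg (n : Sph) : sphereToW2 (-n) = sphereToW2 n := by
  apply Subtype.ext
  change ({projMinus (-n), projPlus (-n)} : Set Op2) = {projMinus n, projPlus n}
  rw [projMinus_eq, projMinus_eq, neg_neg, Set.pair_comm]

lemma eq_or_eq_neg_of_sphereToW2_eq {n m : Sph} (h : sphereToW2 n = sphereToW2 m) :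
    n = m ∨ n = -m := by
  have hmem : projPlus n ∈ ({projMinus m, projPlus m} : Set Op2) :=
    (congrArg Subtype.val h).subset (Set.mem_insert_of_mem _ rfl)
  rcases hmem with hmem | hmem
  · exact .inr (projPlus_injective (hmem.trans (projMinus_eq m)))
  · exact .inl (projPlus_injective hmem)

/-- Every rank-one orthogonal projection is `½(I + n·σ)` for some unit vector `n`. -/
lemma exists_projPlus_eq {p : Op2} (hp : IsProj1 p) : ∃ n : Sph, projPlus n = p := by
  obtain ⟨hsa, hidem, hrank⟩ := hp
  obtain ⟨h0, h1⟩ := (finrank_range_eq_one_iff hidem).1 hrank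
  set T := Matrix.toEuclideanCLM (𝕜 := ℂ) (n := Fin 2) with hT
  obtain ⟨M, rfl⟩ : ∃ M, T M = p := T.surjective p
  have hM : star M = M := T.injective ((map_star T M).trans hsa)
  have hMM : M * M = M := T.injective (by rw [map_mul]; exact hidem)
  have hM0 : M ≠ 0 := fun h => h0 (by rw [h, map_zero])
  have hM1 : M ≠ 1 := fun h => h1 (by rw [h, map_one])
  have e00 := congrFun (congrFun hM 0) 0
  have e10 := congrFun (congrFun hM 1) 0
  have e11 := congrFun (congrFun hM 1) 1
  have f00 := congrFun (congrFun hMM 0) 0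
  have f01 := congrFun (congrFun hMM 0) 1
  have f10 := congrFun (congrFun hMM 1) 0
  have f11 := congrFun (congrFun hMM 1) 1
  simp only [Matrix.mul_apply, Fin.sum_univ_two] at f00 f01 f10 f11
  simp only [Matrix.star_apply] at e00 e10 e11
  have htr : M 0 0 + M 1 1 = 1 := by
    by_contra hne
    have hne' : M 0 0 + M 1 1 - 1 ≠ 0 := sub_ne_zero.2 hne
    have h01 : M 0 1 = 0 := by
      have : M 0 1 * (M 0 0 + M 1 1 - 1) = 0 := by linear_combination f01
      exact (mul_eq_zero.1 this).resolve_right hne'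
    have h10 : M 1 0 = 0 := by
      have : M 1 0 * (M 0 0 + M 1 1 - 1) = 0 := by linear_combination f10
      exact (mul_eq_zero.1 this).resolve_right hne'
    have ha : M 0 0 = 0 ∨ M 0 0 = 1 := by
      have : M 0 0 * (M 0 0 - 1) = 0 := by linear_combination f00 - M 1 0 * h01
      exact (mul_eq_zero.1 this).imp id sub_eq_zero.1
    have hd : M 1 1 = 0 ∨ M 1 1 = 1 := by
      have : M 1 1 * (M 1 1 - 1) = 0 := by linear_combination f11 - M 1 0 * h01
      exact (mul_eq_zero.1 this).imp id sub_eq_zero.1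
    rcases ha with ha | ha <;> rcases hd with hd | hd
    · apply hM0
      ext i j
      fin_cases i <;> fin_cases j <;> simp [*]
    · simp [ha, hd] at hne
    · simp [ha, hd] at hne
    · apply hM1
      ext i j
      fin_cases i <;> fin_cases j <;> simp [*]
  simp only [Complex.star_def, Complex.ext_iff, Complex.conj_re, Complex.conj_im,
    Complex.add_re, Complex.add_im, Complex.mul_re, Complex.mul_im, Complex.one_re,
    Complex.one_im] at e00 e10 e11 f00 f01 f10 f11 htr
  obtain ⟨n, hn⟩ : ∃ n : EuclideanSpace ℝ (Fin 3),
      n = !₂[2 * (M 1 0).re, 2 * (M 1 0).im, 2 * (M 0 0).re - 1] := ⟨_, rfl⟩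
  have hnorm : ‖n‖ = 1 := by
    rw [EuclideanSpace.norm_eq, Real.sqrt_eq_one, Fin.sum_univ_three, hn]
    simp only [Real.norm_eq_abs, sq_abs, Matrix.cons_val]
    have hi : (M 0 0).im = 0 := by linarith [e00.2]
    rw [← e10.1, ← e10.2]
    rw [← e10.1, ← e10.2, hi] at f00
    nlinarith [f00.1]
  refine ⟨⟨n, mem_sphere_zero_iff_norm.2 hnorm⟩, ?_⟩
  simp only [projPlus, nDotSigma_eq_toEuclideanCLM]
  rw [← hT, ← map_one T, ← map_add, ← map_smul]
  congr 1
  subst hn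
  ext i j
  fin_cases i <;> fin_cases j <;>
    simp [pauliMatrix, Complex.ext_iff] <;> grind

lemma W2.exists_eq_pair (O : W2) :
    ∃ p, O.1 = {p, 1 - p} ∧ IsProj1 p := by
  obtain ⟨O, -, hcard, hproj, -, hsum⟩ := O
  obtain ⟨p, q, hpq, rfl⟩ := Set.ncard_eq_two.1 hcard
  rw [finsum_mem_pair hpq] at hsum
  exact ⟨p, congrArg (fun x => ({p, x} : Set Op2)) (eq_sub_of_add_eq' hsum), hproj p (Set.mem_insert _ _)⟩

lemma W2.eq_pair_of_mem (O : W2) {p : Op2} (hp : p ∈ O.1) : O.1 = {p, 1 - p} := by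
  obtain ⟨q, hq, -⟩ := O.exists_eq_pair
  rw [hq] at hp
  rcases hp with rfl | rfl
  · exact hq
  · rw [hq, sub_sub_cancel, Set.pair_comm]

lemma sphereToW2_surjective : Function.Surjective sphereToW2 := by
  intro O
  obtain ⟨p, hO, hp⟩ := O.exists_eq_pair
  obtain ⟨n, rfl⟩ := exists_projPlus_eq hp
  refine ⟨n, Subtype.ext ?_⟩
  rw [hO, Set.pair_comm, ← projMinus_add_projPlus n, add_sub_cancel_right]
  rfl

/-- The unitary operator conjugating `m·σ` to `n·σ` when `n ≠ -m`. -/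
def rotor (n m : Sph) : Op2 :=
  (((√(2 + 2 * inner ℝ (n : EuclideanSpace ℝ (Fin 3)) m))⁻¹ : ℝ) : ℂ) •
    (1 + nDotSigma n * nDotSigma m)

lemma rotor_mem_unitary {n m : Sph} (h : -1 < inner ℝ (n : EuclideanSpace ℝ (Fin 3)) m) :
    rotor n m ∈ unitary Op2 := by
  have hpos : 0 < 2 + 2 * inner ℝ (n : EuclideanSpace ℝ (Fin 3)) m := by linarith
  have key : ∀ a b : Sph, (1 + nDotSigma b * nDotSigma a) * (1 + nDotSigma a * nDotSigma b)
      = ((2 + 2 * inner ℝ (a : EuclideanSpace ℝ (Fin 3)) b : ℝ) : ℂ) • (1 : Op2) := by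
    intro a b
    have hab := nDotSigma_anticommutator (a : EuclideanSpace ℝ (Fin 3)) b
    have h4 : nDotSigma b * nDotSigma a * (nDotSigma a * nDotSigma b) = 1 := by
      rw [mul_assoc, ← mul_assoc (nDotSigma a), nDotSigma_mul_self, one_mul, nDotSigma_mul_self]
    rw [mul_add, add_mul, add_mul, h4, one_mul, one_mul, mul_one]
    calc _ = (2 : ℂ) • (1 : Op2) +
          (nDotSigma a * nDotSigma b + nDotSigma b * nDotSigma a) := by module
      _ = _ := by
        rw [hab]
        push_cast
        module
  have hs : (((√(2 + 2 * inner ℝ (n : EuclideanSpace ℝ (Fin 3)) m))⁻¹ : ℝ) : ℂ) *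
      (((√(2 + 2 * inner ℝ (n : EuclideanSpace ℝ (Fin 3)) m))⁻¹ : ℝ) : ℂ) *
      ((2 + 2 * inner ℝ (n : EuclideanSpace ℝ (Fin 3)) m : ℝ) : ℂ) = 1 := by
    rw [← Complex.ofReal_mul, ← Complex.ofReal_mul, ← mul_inv, Real.mul_self_sqrt hpos.le,
      inv_mul_cancel₀ hpos.ne', Complex.ofReal_one]
  have hstar : star (rotor n m) =
      (((√(2 + 2 * inner ℝ (n : EuclideanSpace ℝ (Fin 3)) m))⁻¹ : ℝ) : ℂ) •
      (1 + nDotSigma m * nDotSigma n) := by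
    have h1 : star (1 + nDotSigma n * nDotSigma m) = 1 + nDotSigma m * nDotSigma n := by
      refine (star_add (1 : Op2) _).trans ?_
      rw [star_mul, star_nDotSigma, star_nDotSigma, star_one]
    rw [rotor, star_smul, h1, Complex.star_def, Complex.conj_ofReal]
  rw [Unitary.mem_iff, hstar, rotor, smul_mul_smul_comm, smul_mul_smul_comm, key n m, key m n,
    real_inner_comm (n : EuclideanSpace ℝ (Fin 3)) m, smul_smul, hs, one_smul]
  exact ⟨rfl, rfl⟩

lemma nDotSigma_mul_rotor (n m : Sph) :
    nDotSigma n * rotor n m = rotor n m * nDotSigma m := by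
  rw [rotor, mul_smul_comm, smul_mul_assoc, mul_add, add_mul, ← mul_assoc, nDotSigma_mul_self,
    mul_assoc, nDotSigma_mul_self, one_mul, mul_one, add_comm (nDotSigma n)]

lemma rotor_conj_image {n m : Sph} (h : -1 < inner ℝ (n : EuclideanSpace ℝ (Fin 3)) m) :
    (fun p => star (rotor n m) * p * rotor n m) '' (sphereToW2 n).1 = (sphereToW2 m).1 := by
  have hu := (Unitary.mem_iff.1 (rotor_mem_unitary h)).1
  have hS : star (rotor n m) * nDotSigma n * rotor n m = nDotSigma m := by
    rw [mul_assoc, nDotSigma_mul_rotor, ← mul_assoc, hu, one_mul]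
  change _ '' ({projMinus n, projPlus n} : Set Op2) = {projMinus m, projPlus m}
  simp only [Set.image_pair, projMinus, projPlus, mul_smul_comm, smul_mul_assoc, mul_add, add_mul,
    mul_sub, sub_mul, mul_one, hu, hS]

lemma rotor_self (n : Sph) : rotor n n = 1 := by
  rw [rotor, nDotSigma_mul_self, real_inner_self_eq_norm_sq, mem_sphere_zero_iff_norm.1 n.2,
    show (2 + 2 * 1 ^ 2 : ℝ) = 2 ^ 2 by norm_num, Real.sqrt_sq zero_le_two,
    show (1 + 1 : Op2) = (2 : ℂ) • (1 : Op2) by module, smul_smul]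
  simp

lemma continuousAt_rotor (m : Sph) : ContinuousAt (fun n => rotor n m) m := by
  have hc : Continuous fun n : Sph => inner ℝ (n : EuclideanSpace ℝ (Fin 3)) m := by fun_prop
  have hS : Continuous fun n : Sph => nDotSigma (n : EuclideanSpace ℝ (Fin 3)) :=
    continuous_nDotSigma.comp continuous_subtype_val
  unfold rotor
  refine ContinuousAt.smul (Complex.continuous_ofReal.continuousAt.comp
    (ContinuousAt.inv₀ (by fun_prop) ?_)) (continuousAt_const.add (hS.continuousAt.mul continuousAt_const))
  rw [real_inner_self_eq_norm_sq, mem_sphere_zero_iff_norm.1 m.2]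
  positivity

lemma exists_unitary_conj_image (O O' : W2) :
    ∃ U ∈ unitary Op2, (fun p => star U * p * U) '' O'.1 = O.1 := by
  obtain ⟨m, rfl⟩ := sphereToW2_surjective O
  obtain ⟨n, rfl⟩ := sphereToW2_surjective O'
  by_cases h : -1 < inner ℝ (n : EuclideanSpace ℝ (Fin 3)) m
  · exact ⟨rotor n m, rotor_mem_unitary h, rotor_conj_image h⟩
  · have h' : -1 < inner ℝ ((-n : Sph) : EuclideanSpace ℝ (Fin 3)) m := by
      rw [coe_neg_sphere, inner_neg_left]
      linarith
    exact ⟨rotor (-n) m, rotor_mem_unitary h', sphereToW2_neg n ▸ rotor_conj_image h'⟩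

lemma DW_lt_iff {O O' : W2} {r : ℝ} :
    DW O.1 O'.1 < r ↔
      ∃ U ∈ unitary Op2, (fun p => star U * p * U) '' O'.1 = O.1 ∧ ‖1 - U‖ < r := by
  constructor
  · intro h
    obtain ⟨V, hV, hV'⟩ := exists_unitary_conj_image O O'
    obtain ⟨_, ⟨U, hU, hU', rfl⟩, hr⟩ := exists_lt_of_csInf_lt (by exact ⟨_, V, hV, hV', rfl⟩) h
    exact ⟨U, hU, hU', hr⟩
  · rintro ⟨U, hU, hU', hr⟩
    refine lt_of_le_of_lt (csInf_le ⟨0, ?_⟩ (by exact ⟨U, hU, hU', rfl⟩)) hr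
    rintro _ ⟨V, -, -, rfl⟩
    exact norm_nonneg _

lemma DW_self_lt (O : W2) {r : ℝ} (hr : 0 < r) : DW O.1 O.1 < r :=
  DW_lt_iff.2 ⟨1, one_mem _, by simp, by simpa using hr⟩

lemma continuous_sphereToW2 : @Continuous Sph W2 _ WTop sphereToW2 := by
  refine continuous_generateFrom_iff.2 ?_
  rintro _ ⟨O, r, rfl⟩
  rw [isOpen_iff_eventually]
  intro m hm
  obtain ⟨U, hU, hUO, hr⟩ := DW_lt_iff.1 hm
  have hinner : ContinuousAt (fun n : Sph => inner ℝ (n : EuclideanSpace ℝ (Fin 3)) m) m := by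
    fun_prop
  have h1 : ∀ᶠ n : Sph in nhds m, -1 < inner ℝ (n : EuclideanSpace ℝ (Fin 3)) m := by
    refine hinner.eventually_const_lt ?_
    beta_reduce
    rw [real_inner_self_eq_norm_sq, mem_sphere_zero_iff_norm.1 m.2]
    norm_num
  have hnorm : ContinuousAt (fun n : Sph => ‖1 - rotor n m * U‖) m :=
    (continuousAt_const.sub ((continuousAt_rotor m).mul continuousAt_const)).norm
  have h2 : ∀ᶠ n : Sph in nhds m, ‖1 - rotor n m * U‖ < r :=
    hnorm.eventually_lt_const (by beta_reduce; rwa [rotor_self, one_mul])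
  filter_upwards [h1, h2] with n hn hn'
  refine DW_lt_iff.2 ⟨_, mul_mem (rotor_mem_unitary hn) hU, ?_, hn'⟩
  rw [← hUO, ← rotor_conj_image hn, Set.image_image]
  simp only [star_mul, mul_assoc]

lemma IsProj1.norm_le_one {p : Op2} (hp : IsProj1 p) : ‖p‖ ≤ 1 := by
  have h := CStarRing.norm_star_mul_self (x := p)
  rw [hp.1.star_eq, hp.2.1] at h
  by_contra! h'
  nlinarith

lemma norm_sub_conj_le {U p : Op2} (hU : U ∈ unitary Op2) (hp : ‖p‖ ≤ 1)
    (hp' : ‖star U * p * U‖ ≤ 1) : ‖p - star U * p * U‖ ≤ 2 * ‖1 - U‖ := by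
  have h : p - star U * p * U = p * (1 - U) - (1 - U) * (star U * p * U) := by
    have hU' : U * (star U * p * U) = p * U := by
      rw [← mul_assoc, ← mul_assoc, (Unitary.mem_iff.1 hU).2, one_mul]
    rw [sub_mul, hU', mul_sub, one_mul, mul_one]
    abel
  rw [h]
  calc _ ≤ ‖p * (1 - U)‖ + ‖(1 - U) * (star U * p * U)‖ := norm_sub_le _ _
    _ ≤ ‖p‖ * ‖1 - U‖ + ‖1 - U‖ * ‖star U * p * U‖ :=
      add_le_add (norm_mul_le _ _) (norm_mul_le _ _)
    _ ≤ 1 * ‖1 - U‖ + ‖1 - U‖ * 1 := by gcongr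
    _ = _ := by ring

lemma exists_norm_sub_lt_of_DW_lt {O O' : W2} {r : ℝ} (h : DW O.1 O'.1 < r) :
    (∀ p ∈ O.1, ∃ q ∈ O'.1, ‖q - p‖ < 2 * r) ∧ (∀ q ∈ O'.1, ∃ p ∈ O.1, ‖q - p‖ < 2 * r) := by
  obtain ⟨U, hU, hUO, hr⟩ := DW_lt_iff.1 h
  have key : ∀ q ∈ O'.1, star U * q * U ∈ O.1 ∧ ‖q - star U * q * U‖ < 2 * r := by
    intro q hq
    have hmem : star U * q * U ∈ O.1 := hUO ▸ Set.mem_image_of_mem _ hq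
    refine ⟨hmem, (norm_sub_conj_le hU (O'.2.2.2.1 q hq).norm_le_one
      (O.2.2.2.1 _ hmem).norm_le_one).trans_lt (by linarith)⟩
  refine ⟨fun p hp => ?_, fun q hq => ⟨_, key q hq⟩⟩
  rw [← hUO] at hp
  obtain ⟨q, hq, rfl⟩ := hp
  exact ⟨q, hq, (key q hq).2⟩

lemma t2Space_WTop : @T2Space W2 WTop := by
  let := WTop
  refine ⟨fun O O' hne => ?_⟩
  obtain ⟨p, hO, -⟩ := O.exists_eq_pair
  have hp : p ∈ O.1 := hO ▸ Set.mem_insert _ _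
  have hp' : p ∉ O'.1 := fun h => hne (Subtype.ext (hO.trans (O'.eq_pair_of_mem h).symm))
  obtain ⟨ε, hε, hball⟩ := Metric.isOpen_iff.1 O'.2.1.isClosed.isOpen_compl p hp'
  have hopen : ∀ Q : W2, IsOpen {Q' : W2 | DW Q.1 Q'.1 < ε / 4} := fun Q =>
    TopologicalSpace.isOpen_generateFrom_of_mem ⟨Q, _, rfl⟩
  refine ⟨_, _, hopen O, hopen O', DW_self_lt O (by positivity), DW_self_lt O' (by positivity),
    Set.disjoint_left.2 fun Q hQ hQ' => ?_⟩
  obtain ⟨q, hq, hqp⟩ := (exists_norm_sub_lt_of_DW_lt hQ).1 p hp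
  obtain ⟨p', hp'', hqp'⟩ := (exists_norm_sub_lt_of_DW_lt hQ').2 q hq
  refine hball (a := p') ?_ hp''
  rw [Metric.mem_ball, dist_eq_norm]
  calc ‖p' - p‖ = ‖(q - p) - (q - p')‖ := by congr 1; abel
    _ ≤ ‖q - p‖ + ‖q - p'‖ := norm_sub_le _ _
    _ < ε := by linarith

/-- The map `S²/{±1} → W(ℂ²)` induced by `sphereToW2`. -/
def projectivePlaneToW2 : Quot antipodal → W2 :=
  Quot.lift sphereToW2 fun n m h => by
    rw [show m = -n from Subtype.ext h, sphereToW2_neg]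

lemma projectivePlaneToW2_bijective : Function.Bijective projectivePlaneToW2 := by
  refine ⟨?_, fun O => ?_⟩
  · rintro ⟨n⟩ ⟨m⟩ h
    rcases eq_or_eq_neg_of_sphereToW2_eq (n := n) (m := m) h with rfl | rfl
    · rfl
    · exact (Quot.sound (show antipodal m (-m) from rfl)).symm
  · obtain ⟨n, rfl⟩ := sphereToW2_surjective O
    exact ⟨Quot.mk _ n, rfl⟩

/-- `W(ℂ²)` is homeomorphic to the real projective plane `S²/{±1}`: there is a
bijection `F : S²/{±1} ≃ W(ℂ²)`, continuous with continuous inverse (with respect to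
the quotient topology and the topology of the metric `D_W`), induced by
`n ↦ {½(I − n·σ), ½(I + n·σ)}`. -/
theorem W2_homeomorphic_projective_plane :
    ∃ F : Quot antipodal ≃ W2,
      (@Continuous (Quot antipodal) W2 _ WTop F) ∧
      (@Continuous W2 (Quot antipodal) WTop _ F.symm) ∧
      (∀ n : Sph, (F (Quot.mk antipodal n)).1 = {projMinus n, projPlus n}) := by
  let := WTop
  have := t2Space_WTop
  have hF : Continuous (Equiv.ofBijective _ projectivePlaneToW2_bijective) :=
    continuous_quot_lift _ continuous_sphereToW2
  exact ⟨_, hF, hF.continuous_symm_of_equiv_compact_to_t2, fun _ => rfl⟩
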